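/- In the setting of the rounding-and-contraction construction, assume additionally that w(u,v) = dist_G(u,v) for every edge (u,v) ∈ E, that W is the maximum edge weight of G, that |E| < 3n and 3n ≤ W, and that w'(H') ≤ C·w'(G'_{opt,2ε}) for some real C ≥ 1, where G'_{opt,2ε} denotes a minimum-weight (1+2ε)-spanner of G'. Then w(H) ≤ (4C + 4)·w(G_{opt,ε}), where G_{opt,ε} denotes a minimum-weight (1+ε)-spanner of G. -/

import Mathlib

open scoped BigOperators

namespace Paper

variable {V : Type*}

/-- The weight of a walk: the sum of its edge weights, with multiplicity. -/
noncomputable def wWalk (w : V → V → ℝ) {G : SimpleGraph V} {u v : V} (p : G.Walk u v) : ℝ :=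
  (p.darts.map fun d => w d.toProd.1 d.toProd.2).sum

/-- The distance between two vertices: the infimum of the weights of walks
between them, `⊤` if there is none. -/
noncomputable def gdist (G : SimpleGraph V) (w : V → V → ℝ) (u v : V) : EReal :=
  ⨅ p : G.Walk u v, (wWalk w p : EReal)

/-- `H` is a `t`-spanner of `G` with respect to the weights `w`. -/
def IsSpanner (G : SimpleGraph V) (w : V → V → ℝ) (H : SimpleGraph V) (t : ℝ) : Prop :=
  H ≤ G ∧ ∀ u v : V, gdist H w u v ≤ (t : EReal) * gdist G w u v

/-- The total weight of the edges of a graph. -/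
noncomputable def wGraph (G : SimpleGraph V) (w : V → V → ℝ)
    (hw : ∀ a b, w a b = w b a) : ℝ :=
  ∑ᶠ e ∈ G.edgeSet, Sym2.lift ⟨w, hw⟩ e

/-- The subgraph of `G` consisting of the edges of weight less than `c`. -/
def lightG (G : SimpleGraph V) (w : V → V → ℝ) (c : ℝ) : SimpleGraph V :=
  SimpleGraph.fromRel fun u v => G.Adj u v ∧ w u v < c

/-- The vertices of the contracted graph: connected components spanned by the
edges of weight less than `c`. -/
abbrev CComp (G : SimpleGraph V) (w : V → V → ℝ) (c : ℝ) : Type _ :=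
  (lightG G w c).ConnectedComponent

/-- The contraction map. -/
def cmk (G : SimpleGraph V) (w : V → V → ℝ) (c : ℝ) (u : V) : CComp G w c :=
  (lightG G w c).connectedComponentMk u

/-- The contracted graph `G'`: two distinct components are adjacent iff `G` has an
edge between them. -/
def contrG (G : SimpleGraph V) (w : V → V → ℝ) (c : ℝ) : SimpleGraph (CComp G w c) :=
  SimpleGraph.fromRel fun C D => ∃ u v, G.Adj u v ∧ cmk G w c u = C ∧ cmk G w c v = D

/-- The rounded weight on the contracted graph: `⌊(minimum weight of an edge of `G`
between the two components) · fac⌋`. -/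
noncomputable def cW (G : SimpleGraph V) (w : V → V → ℝ) (c fac : ℝ)
    (C D : CComp G w c) : ℝ :=
  ((⌊sInf {r : ℝ | ∃ u v, G.Adj u v ∧ w u v = r ∧
      ((cmk G w c u = C ∧ cmk G w c v = D) ∨ (cmk G w c u = D ∧ cmk G w c v = C))}
    * fac⌋ : ℤ) : ℝ)

lemma cW_symm (G : SimpleGraph V) (w : V → V → ℝ) (c fac : ℝ) :
    ∀ C D : CComp G w c, cW G w c fac C D = cW G w c fac D C := by
  intro C D
  have h : {r : ℝ | ∃ u v, G.Adj u v ∧ w u v = r ∧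
        ((cmk G w c u = C ∧ cmk G w c v = D) ∨ (cmk G w c u = D ∧ cmk G w c v = C))}
      = {r : ℝ | ∃ u v, G.Adj u v ∧ w u v = r ∧
        ((cmk G w c u = D ∧ cmk G w c v = C) ∨ (cmk G w c u = C ∧ cmk G w c v = D))} := by
    ext r
    constructor <;> (rintro ⟨u, v, h1, h2, h3⟩; exact ⟨u, v, h1, h2, h3.symm⟩)
  unfold cW
  rw [h]

/-! ### Helper lemmas -/

open scoped Classical in
lemma wGraph_eq_sum [Fintype V] (G : SimpleGraph V) (w : V → V → ℝ) (hw : ∀ a b, w a b = w b a) :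
    wGraph G w hw = ∑ e ∈ G.edgeFinset, Sym2.lift ⟨w, hw⟩ e := by
  unfold wGraph
  rw [← SimpleGraph.coe_edgeFinset, finsum_mem_coe_finset]

lemma wWalk_nil (w : V → V → ℝ) {G : SimpleGraph V} {u : V} :
    wWalk w (SimpleGraph.Walk.nil : G.Walk u u) = 0 := by
  simp [wWalk]

lemma wWalk_cons (w : V → V → ℝ) {G : SimpleGraph V} {u v x : V} (h : G.Adj u v)
    (p : G.Walk v x) : wWalk w (SimpleGraph.Walk.cons h p) = w u v + wWalk w p := by
  simp [wWalk]

lemma wWalk_append (w : V → V → ℝ) {G : SimpleGraph V} {u v x : V} (p : G.Walk u v)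
    (q : G.Walk v x) : wWalk w (p.append q) = wWalk w p + wWalk w q := by
  simp [wWalk]

lemma wWalk_edges (w : V → V → ℝ) (hw : ∀ a b, w a b = w b a) {G : SimpleGraph V} {u v : V}
    (p : G.Walk u v) : wWalk w p = (p.edges.map (Sym2.lift ⟨w, hw⟩)).sum := by
  induction p with
  | nil => simp [wWalk]
  | cons h p ih => rw [wWalk_cons, ih]; simp

lemma wWalk_mapLe (w : V → V → ℝ) {K G : SimpleGraph V} (hKG : K ≤ G) {u v : V}
    (p : K.Walk u v) : ∃ q : G.Walk u v, wWalk w q = wWalk w p := by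
  induction p with
  | nil => exact ⟨.nil, by simp [wWalk_nil]⟩
  | cons h p ih =>
    obtain ⟨q, hq⟩ := ih
    exact ⟨.cons (hKG h) q, by simp [wWalk_cons, hq]⟩

lemma gdist_le (G : SimpleGraph V) (w : V → V → ℝ) {u v : V} (p : G.Walk u v) :
    gdist G w u v ≤ (wWalk w p : EReal) := iInf_le _ p

/-- A spanner has weight at least the weight of any metric edge. -/
lemma le_wGraph_of_spanner [Fintype V] (G : SimpleGraph V) (w : V → V → ℝ)
    (hw : ∀ a b, w a b = w b a) (hpos : ∀ u v, G.Adj u v → 0 ≤ w u v)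
    (K : SimpleGraph V) (t : ℝ) (hK : IsSpanner G w K t) (u v : V)
    (hd : gdist G w u v = ((w u v : ℝ) : EReal)) : w u v ≤ wGraph K w hw := by
  classical
  have h1 : gdist K w u v < ⊤ := by
    refine lt_of_le_of_lt (hK.2 u v) ?_
    rw [hd, ← EReal.coe_mul]
    exact EReal.coe_lt_top _
  obtain ⟨p, -⟩ := iInf_lt_iff.1 h1
  have hp := p.bypass_isPath
  obtain ⟨q, hq⟩ := wWalk_mapLe w hK.1 p.bypass
  have h2 := gdist_le G w q
  rw [hd, hq, EReal.coe_le_coe_iff] at h2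
  refine h2.trans ?_
  rw [wWalk_edges w hw, wGraph_eq_sum, ← List.sum_toFinset _ hp.isTrail.edges_nodup]
  apply Finset.sum_le_sum_of_subset_of_nonneg
  · intro e he
    rw [SimpleGraph.mem_edgeFinset]
    exact p.bypass.edges_subset_edgeSet (List.mem_toFinset.1 he)
  · intro e he _
    rw [SimpleGraph.mem_edgeFinset] at he
    induction e with
    | _ a b => exact hpos a b (hK.1 he)

/-- The set of weights between two components. -/
def wset (G : SimpleGraph V) (w : V → V → ℝ) (c : ℝ) (C D : CComp G w c) : Set ℝ :=
  {r : ℝ | ∃ u v, G.Adj u v ∧ w u v = r ∧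
      ((cmk G w c u = C ∧ cmk G w c v = D) ∨ (cmk G w c u = D ∧ cmk G w c v = C))}

lemma cW_eq (G : SimpleGraph V) (w : V → V → ℝ) (c fac : ℝ) (C D : CComp G w c) :
    cW G w c fac C D = ((⌊sInf (wset G w c C D) * fac⌋ : ℤ) : ℝ) := rfl

lemma wset_finite [Fintype V] (G : SimpleGraph V) (w : V → V → ℝ) (c : ℝ) (C D : CComp G w c) :
    (wset G w c C D).Finite := by
  refine (Set.finite_range (fun p : V × V => w p.1 p.2)).subset ?_
  rintro r ⟨u, v, -, h, -⟩
  exact ⟨(u, v), h⟩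

lemma cW_le [Fintype V] (G : SimpleGraph V) (w : V → V → ℝ) (c fac : ℝ) (hc : 0 < c)
    (hfac : fac * c = 1) {u v : V} (h : G.Adj u v) :
    c * cW G w c fac (cmk G w c u) (cmk G w c v) ≤ w u v := by
  have hf : 0 < fac := by
    by_contra hcon
    nlinarith
  have h1 : sInf (wset G w c (cmk G w c u) (cmk G w c v)) ≤ w u v :=
    csInf_le (wset_finite G w c _ _).bddBelow ⟨u, v, h, rfl, Or.inl ⟨rfl, rfl⟩⟩
  rw [cW_eq]
  have h2 := Int.floor_le (sInf (wset G w c (cmk G w c u) (cmk G w c v)) * fac)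
  calc _ ≤ c * (sInf (wset G w c (cmk G w c u) (cmk G w c v)) * fac) := by gcongr
    _ = sInf (wset G w c (cmk G w c u) (cmk G w c v)) * (fac * c) := by ring
    _ ≤ w u v := by rw [hfac, mul_one]; exact h1

lemma contrG_adj {G : SimpleGraph V} {w : V → V → ℝ} {c : ℝ} {C D : CComp G w c}
    (h : (contrG G w c).Adj C D) :
    C ≠ D ∧ ∃ u v, G.Adj u v ∧ cmk G w c u = C ∧ cmk G w c v = D := by
  rw [contrG, SimpleGraph.fromRel_adj] at h
  refine ⟨h.1, ?_⟩
  rcases h.2 with h | ⟨u, v, h1, h2, h3⟩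
  · exact h
  · exact ⟨v, u, h1.symm, h3, h2⟩

lemma contrG_adj_of {G : SimpleGraph V} {w : V → V → ℝ} {c : ℝ} {u v : V}
    (h : G.Adj u v) (hne : cmk G w c u ≠ cmk G w c v) :
    (contrG G w c).Adj (cmk G w c u) (cmk G w c v) := by
  rw [contrG, SimpleGraph.fromRel_adj]
  exact ⟨hne, Or.inl ⟨u, v, h, rfl, rfl⟩⟩

lemma cmk_le {G : SimpleGraph V} {w : V → V → ℝ} {c : ℝ} {u v : V}
    (h : G.Adj u v) (hne : cmk G w c u ≠ cmk G w c v) : c ≤ w u v := by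
  by_contra hcon
  apply hne
  unfold cmk
  rw [SimpleGraph.ConnectedComponent.eq]
  apply SimpleGraph.Adj.reachable
  rw [lightG, SimpleGraph.fromRel_adj]
  exact ⟨h.ne, Or.inl ⟨h, not_le.1 hcon⟩⟩

/-- minimal edge between adjacent components -/
lemma exists_min_edge [Fintype V] {G : SimpleGraph V} {w : V → V → ℝ}
    (hw : ∀ a b, w a b = w b a) {c fac : ℝ} (hc : 0 < c) (hfac : fac * c = 1)
    {C D : CComp G w c} (h : (contrG G w c).Adj C D) :
    ∃ u v, G.Adj u v ∧ cmk G w c u = C ∧ cmk G w c v = D ∧ 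
      w u v < c * (cW G w c fac C D + 1) := by
  obtain ⟨hne, u, v, h1, h2, h3⟩ := contrG_adj h
  have hmem : sInf (wset G w c C D) ∈ wset G w c C D :=
    Set.Nonempty.csInf_mem ⟨w u v, u, v, h1, rfl, Or.inl ⟨h2, h3⟩⟩ (wset_finite G w c C D)
  have key : sInf (wset G w c C D) < c * (cW G w c fac C D + 1) := by
    rw [cW_eq]
    have h4 := Int.lt_floor_add_one (sInf (wset G w c C D) * fac)
    calc _ = c * (sInf (wset G w c C D) * fac) := by
          rw [mul_comm, mul_assoc, hfac, mul_one]
      _ < _ := by gcongr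
  obtain ⟨a, b, h5, h6, h7⟩ := hmem
  rcases h7 with ⟨h7, h8⟩ | ⟨h7, h8⟩
  · exact ⟨a, b, h5, h7, h8, h6 ▸ key⟩
  · exact ⟨b, a, h5.symm, h8, h7, by rw [hw b a, h6]; exact key⟩

lemma cW_nonneg [Fintype V] {G : SimpleGraph V} {w : V → V → ℝ}
    (hw : ∀ a b, w a b = w b a) {c fac : ℝ} (hc : 0 < c) (hfac : fac * c = 1)
    {C D : CComp G w c} (h : (contrG G w c).Adj C D) : 0 ≤ cW G w c fac C D := by
  obtain ⟨u, v, h1, h2, h3, h4⟩ := exists_min_edge hw hc hfac h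
  have h5 := cmk_le h1 (by rw [h2, h3]; exact h.ne)
  have h6 : 0 < cW G w c fac C D + 1 - 1 + 1 - 1 + 1 := by nlinarith
  by_contra hcon
  nlinarith

/-- contraction of a spanner together with the light edges -/
def contrK (G : SimpleGraph V) (w : V → V → ℝ) (c fac τ : ℝ) (K : SimpleGraph V) :
    SimpleGraph (CComp G w c) :=
  SimpleGraph.fromRel fun C D => (contrG G w c).Adj C D ∧
    ((∃ u v, K.Adj u v ∧ cmk G w c u = C ∧ cmk G w c v = D) ∨ c * cW G w c fac C D ≤ τ)

lemma contrK_adj {G : SimpleGraph V} {w : V → V → ℝ} {c fac τ : ℝ} {K : SimpleGraph V}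
    {C D : CComp G w c} : (contrK G w c fac τ K).Adj C D ↔ (contrG G w c).Adj C D ∧
    ((∃ u v, K.Adj u v ∧ cmk G w c u = C ∧ cmk G w c v = D) ∨ c * cW G w c fac C D ≤ τ) := by
  rw [contrK, SimpleGraph.fromRel_adj]
  constructor
  · rintro ⟨hne, h | ⟨h1, h2⟩⟩
    · exact h
    · refine ⟨h1.symm, ?_⟩
      rcases h2 with ⟨u, v, h3, h4, h5⟩ | h2
      · exact Or.inl ⟨v, u, h3.symm, h5, h4⟩
      · right; rwa [cW_symm]
  · intro h
    exact ⟨h.1.ne, Or.inl h⟩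

lemma contract_walk [Fintype V] {G : SimpleGraph V} {w : V → V → ℝ}
    (hpos : ∀ u v, G.Adj u v → 0 ≤ w u v) {c fac τ : ℝ} (hc : 0 < c) (hfac : fac * c = 1)
    {K : SimpleGraph V} (hK : K ≤ G) {u v : V} (p : K.Walk u v) :
    ∃ q : (contrK G w c fac τ K).Walk (cmk G w c u) (cmk G w c v),
      c * wWalk (cW G w c fac) q ≤ wWalk w p := by
  induction p with
  | nil => exact ⟨.nil, by simp [wWalk_nil]⟩
  | @cons a b d h p ih =>
    obtain ⟨q, hq⟩ := ih
    by_cases hab : cmk G w c a = cmk G w c b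
    · rw [hab]
      refine ⟨q, ?_⟩
      rw [wWalk_cons]
      linarith [hpos a b (hK h)]
    · refine ⟨.cons (contrK_adj.2 ⟨contrG_adj_of (hK h) hab, Or.inl ⟨a, b, h, rfl, rfl⟩⟩) q, ?_⟩
      rw [wWalk_cons, wWalk_cons, mul_add]
      linarith [cW_le G w c fac hc hfac (hK h)]

lemma contrK_spanner [Fintype V] {G : SimpleGraph V} {w : V → V → ℝ}
    (hw : ∀ a b, w a b = w b a)
    (hpos : ∀ u v, G.Adj u v → 0 ≤ w u v) {c fac : ℝ} (hc : 0 < c) (hfac : fac * c = 1)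
    {K : SimpleGraph V} {ε : ℝ} (hε : 0 < ε) (hK : IsSpanner G w K (1 + ε))
    (hmetric : ∀ u v : V, G.Adj u v → gdist G w u v = ((w u v : ℝ) : EReal)) :
    IsSpanner (contrG G w c) (cW G w c fac) (contrK G w c fac (c * (1 + 1 / ε)) K)
      (1 + 2 * ε) := by
  set τ := c * (1 + 1 / ε) with hτ
  refine ⟨fun C D h => (contrK_adj.1 h).1, ?_⟩
  have edge : ∀ C D, (contrG G w c).Adj C D → ∃ q : (contrK G w c fac τ K).Walk C D,
      wWalk (cW G w c fac) q ≤ (1 + 2 * ε) * cW G w c fac C D := by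
    intro C D h
    have hnn := cW_nonneg hw hc hfac h
    by_cases hl : c * cW G w c fac C D ≤ τ
    · refine ⟨.cons (contrK_adj.2 ⟨h, Or.inr hl⟩) .nil, ?_⟩
      rw [wWalk_cons, wWalk_nil]
      nlinarith
    · obtain ⟨u, v, h1, rfl, rfl, h4⟩ := exists_min_edge hw hc hfac h
      set x := cW G w c fac (cmk G w c u) (cmk G w c v) with hx
      have hx1 : 1 + 1 / ε < x := by
        rw [hτ] at hl
        exact lt_of_mul_lt_mul_left (not_le.1 hl) hc.le
      have hx2 : 1 + ε < ε * x := by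
        have : ε * (1 + 1 / ε) = 1 + ε := by field_simp; ring
        rw [← this]; gcongr
      have h5 : (1 + ε) * w u v < c * ((1 + 2 * ε) * x) := by
        calc (1 + ε) * w u v < (1 + ε) * (c * (x + 1)) := by gcongr
          _ = c * ((1 + ε) * (x + 1)) := by ring
          _ ≤ _ := by
            apply mul_le_mul_of_nonneg_left _ hc.le
            nlinarith
      have h6 : gdist K w u v < ((c * ((1 + 2 * ε) * x) : ℝ) : EReal) := by
        refine lt_of_le_of_lt (hK.2 u v) ?_
        rw [hmetric u v h1, ← EReal.coe_mul, EReal.coe_lt_coe_iff]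
        exact h5
      obtain ⟨p, hp⟩ := iInf_lt_iff.1 h6
      rw [EReal.coe_lt_coe_iff] at hp
      obtain ⟨q, hq⟩ := contract_walk (τ := τ) hpos hc hfac hK.1 p
      exact ⟨q, le_of_mul_le_mul_left (hq.trans hp.le) hc⟩
  have walk : ∀ C D, ∀ p : (contrG G w c).Walk C D, ∃ q : (contrK G w c fac τ K).Walk C D,
      wWalk (cW G w c fac) q ≤ (1 + 2 * ε) * wWalk (cW G w c fac) p := by
    intro C D p
    induction p with
    | nil => exact ⟨.nil, by simp [wWalk_nil]⟩
    | cons h p ih =>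
      obtain ⟨q, hq⟩ := ih
      obtain ⟨q', hq'⟩ := edge _ _ h
      refine ⟨q'.append q, ?_⟩
      rw [wWalk_append, wWalk_cons]
      linarith
  intro C D
  have ht : (0 : ℝ) < 1 + 2 * ε := by linarith
  rw [← EReal.div_le_iff_le_mul (by exact_mod_cast ht) (EReal.coe_ne_top _)]
  refine le_iInf fun p => ?_
  rw [EReal.div_le_iff_le_mul (by exact_mod_cast ht) (EReal.coe_ne_top _)]
  obtain ⟨q, hq⟩ := walk C D p
  refine (gdist_le _ _ q).trans ?_
  rw [← EReal.coe_mul, EReal.coe_le_coe_iff]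
  exact hq

open scoped Classical in
lemma contrK_weight [Fintype V] {G : SimpleGraph V} {w : V → V → ℝ}
    (hw : ∀ a b, w a b = w b a)
    (hpos : ∀ u v, G.Adj u v → 0 ≤ w u v) {c fac τ : ℝ} (hc : 0 < c) (hfac : fac * c = 1)
    {K : SimpleGraph V} (hK : K ≤ G) (hτ : 0 ≤ τ) :
    c * wGraph (contrK G w c fac τ K) (cW G w c fac) (cW_symm G w _ _) ≤
      wGraph K w hw + G.edgeFinset.card * τ := by
  let _ : Fintype (CComp G w c) := Fintype.ofFinite _
  set f : Sym2 V → ℝ := Sym2.lift ⟨w, hw⟩ with hf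
  set f' : Sym2 (CComp G w c) → ℝ := Sym2.lift ⟨cW G w c fac, cW_symm G w _ _⟩ with hf'
  set t : Sym2 V → ℝ := fun e => (if e ∈ K.edgeFinset then f e else 0) + τ with ht
  have hfK : ∀ e, e ∈ K.edgeFinset → 0 ≤ f e := by
    intro e he
    rw [SimpleGraph.mem_edgeFinset] at he
    induction e with
    | _ a b => exact hpos a b (hK he)
  have htn : ∀ e, τ ≤ t e := by
    intro e
    simp only [ht]
    split_ifs with h
    · linarith [hfK e h]
    · linarith
  have ex : ∀ e' : Sym2 (CComp G w c), ∃ e : Sym2 V,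
      e' ∈ (contrK G w c fac τ K).edgeFinset →
      e ∈ G.edgeFinset ∧ e.map (cmk G w c) = e' ∧ c * f' e' ≤ t e := by
    intro e'
    by_cases he : e' ∈ (contrK G w c fac τ K).edgeFinset
    swap
    · obtain ⟨⟨a, b⟩, rfl⟩ := Sym2.mk_surjective e'
      obtain ⟨x, -⟩ := a.exists_rep
      exact ⟨s(x, x), fun h => absurd h he⟩
    induction e' with
    | _ C D =>
      rw [SimpleGraph.mem_edgeFinset, SimpleGraph.mem_edgeSet, contrK_adj] at he
      obtain ⟨h1, ⟨u, v, h2, rfl, rfl⟩ | h2⟩ := he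
      · refine ⟨s(u, v), fun _ => ⟨by simpa using hK h2, rfl, ?_⟩⟩
        have h3 : s(u, v) ∈ K.edgeFinset := by simpa using h2
        simp only [ht, if_pos h3]
        have := cW_le G w c fac hc hfac (hK h2)
        simp only [hf, hf', Sym2.lift_mk]
        linarith
      · obtain ⟨-, u, v, h3, h4, h5⟩ := contrG_adj h1
        refine ⟨s(u, v), fun _ => ⟨by simpa using h3, by simp [h4, h5], ?_⟩⟩
        exact le_trans h2 (htn _)
  choose g hg using ex
  rw [wGraph_eq_sum, wGraph_eq_sum, Finset.mul_sum]
  calc _ ≤ ∑ e' ∈ (contrK G w c fac τ K).edgeFinset, t (g e') :=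
        Finset.sum_le_sum fun e' he' => (hg e' he').2.2
    _ = ∑ e ∈ (contrK G w c fac τ K).edgeFinset.image g, t e := by
        rw [Finset.sum_image]
        intro a ha b hb hab
        rw [← (hg a ha).2.1, ← (hg b hb).2.1, hab]
    _ ≤ ∑ e ∈ G.edgeFinset, t e := by
        apply Finset.sum_le_sum_of_subset_of_nonneg
        · intro e he
          obtain ⟨e', he', rfl⟩ := Finset.mem_image.1 he
          exact (hg e' he').1
        · intro e _ _
          exact hτ.trans (htn e)
    _ = _ := by
        simp only [ht]
        rw [Finset.sum_add_distrib, Finset.sum_ite_mem, Finset.sum_const, nsmul_eq_mul]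
        congr 2
        exact Finset.inter_eq_right.2 (SimpleGraph.edgeFinset_subset_edgeFinset.2 hK)

open scoped Classical in
lemma H_weight [Fintype V] {G : SimpleGraph V} {w : V → V → ℝ}
    (hw : ∀ a b, w a b = w b a) {c fac M : ℝ} (hc : 0 < c) (hfac : fac * c = 1)
    (hcM : c ≤ M) (H' : SimpleGraph (CComp G w c)) (hH' : H' ≤ contrG G w c)
    (F : CComp G w c → CComp G w c → V × V)
    (hFadj : ∀ C D, H'.Adj C D → G.Adj (F C D).1 (F C D).2 ∧
        cmk G w _ (F C D).1 = C ∧ cmk G w _ (F C D).2 = D)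
    (hFmin : ∀ C D, H'.Adj C D → ∀ u v : V, G.Adj u v →
        cmk G w _ u = C → cmk G w _ v = D → w (F C D).1 (F C D).2 ≤ w u v)
    (H : SimpleGraph V)
    (hHdef : H = SimpleGraph.fromEdgeSet
        ({e ∈ G.edgeSet | Sym2.lift ⟨w, hw⟩ e ≤ M} ∪
         {e | ∃ C D, H'.Adj C D ∧ e = s((F C D).1, (F C D).2)})) :
    wGraph H w hw ≤ G.edgeFinset.card * M +
      2 * (c * wGraph H' (cW G w c fac) (cW_symm G w _ _)) := by
  let _ : Fintype (CComp G w c) := Fintype.ofFinite _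
  set f : Sym2 V → ℝ := Sym2.lift ⟨w, hw⟩ with hf
  set f' : Sym2 (CComp G w c) → ℝ := Sym2.lift ⟨cW G w c fac, cW_symm G w _ _⟩ with hf'
  have hH : ∀ e ∈ H.edgeFinset, (e ∈ G.edgeFinset ∧ f e ≤ M) ∨
      ∃ C D, H'.Adj C D ∧ e = s((F C D).1, (F C D).2) := by
    intro e he
    rw [SimpleGraph.mem_edgeFinset, hHdef, SimpleGraph.edgeSet_fromEdgeSet] at he
    rcases he.1 with h | h
    · exact Or.inl ⟨by simpa using h.1, h.2⟩
    · exact Or.inr h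
  have hHG : H.edgeFinset ⊆ G.edgeFinset := by
    intro e he
    rcases hH e he with h | ⟨C, D, h, rfl⟩
    · exact h.1
    · simpa using (hFadj C D h).1
  have hf'n : ∀ e' ∈ H'.edgeFinset, 0 ≤ f' e' := by
    intro e' he'
    rw [SimpleGraph.mem_edgeFinset] at he'
    induction e' with
    | _ a b => exact cW_nonneg hw hc hfac (hH' he')
  set B := H.edgeFinset.filter (fun e => ¬ f e ≤ M) with hB
  have hBF : ∀ e ∈ B, ∃ C D, H'.Adj C D ∧ e = s((F C D).1, (F C D).2) := by
    intro e he
    rw [hB, Finset.mem_filter] at he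
    exact (hH e he.1).resolve_left fun h => he.2 h.2
  have hmapF : ∀ C D, H'.Adj C D → 
      Sym2.map (cmk G w c) s((F C D).1, (F C D).2) = s(C, D) := by
    intro C D h
    rw [Sym2.map_mk, (hFadj C D h).2.1, (hFadj C D h).2.2]
  have hmaps : ∀ e ∈ B, Sym2.map (cmk G w c) e ∈ H'.edgeFinset := by
    intro e he
    obtain ⟨C, D, h, rfl⟩ := hBF e he
    rw [hmapF C D h]
    simpa using h
  have hBw : ∀ e ∈ B, f e ≤ c * f' (Sym2.map (cmk G w c) e) + M := by
    intro e he
    obtain ⟨C, D, h, rfl⟩ := hBF e he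
    rw [hmapF C D h]
    obtain ⟨u, v, h1, h2, h3, h4⟩ := exists_min_edge hw hc hfac (hH' h)
    have := hFmin C D h u v h1 h2 h3
    simp only [hf, hf', Sym2.lift_mk]
    linarith
  have hsum : ∑ e ∈ B, f' (Sym2.map (cmk G w c) e) ≤ 2 * ∑ e' ∈ H'.edgeFinset, f' e' := by
    rw [← Finset.sum_fiberwise_of_maps_to hmaps, Finset.mul_sum]
    apply Finset.sum_le_sum
    intro e' he'
    have h1 : ∑ e ∈ B with Sym2.map (cmk G w c) e = e', f' (Sym2.map (cmk G w c) e) =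
        (B.filter (fun e => Sym2.map (cmk G w c) e = e')).card * f' e' := by
      rw [← nsmul_eq_mul, ← Finset.sum_const]
      apply Finset.sum_congr rfl
      intro e he
      rw [(Finset.mem_filter.1 he).2]
    rw [h1]
    apply mul_le_mul_of_nonneg_right _ (hf'n e' he')
    have h2 : (B.filter (fun e => Sym2.map (cmk G w c) e = e')).card ≤ 2 := by
      induction e' with
      | _ C D =>
        refine le_trans (Finset.card_le_card (t := {s((F C D).1, (F C D).2),
          s((F D C).1, (F D C).2)}) ?_) Finset.card_le_two
        intro e he
        obtain ⟨he1, he2⟩ := Finset.mem_filter.1 he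
        obtain ⟨C1, D1, h, rfl⟩ := hBF e he1
        rw [hmapF C1 D1 h, Sym2.eq_iff] at he2
        rcases he2 with ⟨rfl, rfl⟩ | ⟨rfl, rfl⟩ <;> simp
    exact_mod_cast h2
  have hM : 0 ≤ M := hc.le.trans hcM
  rw [wGraph_eq_sum, wGraph_eq_sum]
  have h1 : ∑ e ∈ H.edgeFinset, f e ≤ 
      ∑ e ∈ H.edgeFinset, (M + if ¬ f e ≤ M then c * f' (Sym2.map (cmk G w c) e) else 0) := by
    apply Finset.sum_le_sum
    intro e he
    split_ifs with h
    · linarith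
    · have := hBw e (Finset.mem_filter.2 ⟨he, h⟩)
      linarith
  rw [Finset.sum_add_distrib, ← Finset.sum_filter, ← Finset.mul_sum, Finset.sum_const,
    nsmul_eq_mul] at h1
  have h2 : (H.edgeFinset.card : ℝ) ≤ G.edgeFinset.card := by
    exact_mod_cast Finset.card_le_card hHG
  have h3 := mul_le_mul_of_nonneg_left hsum hc.le
  have h4 := mul_le_mul_of_nonneg_right h2 hM
  refine h1.trans ?_
  rw [mul_left_comm]
  exact add_le_add h4 h3

/-- in the rounding-and-contraction construction, if moreover every edge
weight equals the distance between its endpoints, `W` is the maximum edge weight,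
`|E| < 3n`, `3n ≤ W`, and `w'(H') ≤ C·w'(G'_opt,2ε)` (expressed by comparison with every
`(1+2ε)`-spanner of `G'`), then `w(H) ≤ (4C+4)·w(G_opt,ε)` (expressed by comparison with
every `(1+ε)`-spanner of `G`). -/
theorem statement13 [Fintype V] (G : SimpleGraph V) (w : V → V → ℝ)
    (hw : ∀ a b, w a b = w b a)
    (W : ℕ) (hWpos : 0 < W)
    (hint : ∀ u v : V, G.Adj u v → ∃ m : ℕ, 1 ≤ m ∧ m ≤ W ∧ w u v = m)
    (hn : 2 ≤ Fintype.card V)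
    (ε : ℝ) (hε0 : 0 < ε) (hε : ε ≤ 1/2) (ε₀ : ℝ) (hε₀ : 0 < ε₀)
    (H' : SimpleGraph (CComp G w (ε * W / (Fintype.card V : ℝ)^2)))
    (hH' : IsSpanner (contrG G w (ε * W / (Fintype.card V : ℝ)^2))
        (cW G w (ε * W / (Fintype.card V : ℝ)^2) ((Fintype.card V : ℝ)^2 / (W * ε)))
        H' (1 + ε₀))
    (F : CComp G w (ε * W / (Fintype.card V : ℝ)^2) →
         CComp G w (ε * W / (Fintype.card V : ℝ)^2) → V × V)
    (hFadj : ∀ C D, H'.Adj C D → G.Adj (F C D).1 (F C D).2 ∧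
        cmk G w _ (F C D).1 = C ∧ cmk G w _ (F C D).2 = D)
    (hFmin : ∀ C D, H'.Adj C D → ∀ u v : V, G.Adj u v →
        cmk G w _ u = C → cmk G w _ v = D → w (F C D).1 (F C D).2 ≤ w u v)
    (H : SimpleGraph V)
    (hHdef : H = SimpleGraph.fromEdgeSet
        ({e ∈ G.edgeSet | Sym2.lift ⟨w, hw⟩ e ≤ (W : ℝ) / (Fintype.card V : ℝ)} ∪
         {e | ∃ C D, H'.Adj C D ∧ e = s((F C D).1, (F C D).2)}))
    (hmetric : ∀ u v : V, G.Adj u v → gdist G w u v = ((w u v : ℝ) : EReal))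
    (hmax : ∀ u v : V, G.Adj u v → w u v ≤ W)
    (hmaxattained : ∃ u v : V, G.Adj u v ∧ w u v = W)
    (hE3n : G.edgeSet.ncard < 3 * Fintype.card V)
    (h3nW : 3 * Fintype.card V ≤ W)
    (C₀ : ℝ) (hC₀ : 1 ≤ C₀)
    (hH'opt : ∀ K : SimpleGraph (CComp G w (ε * W / (Fintype.card V : ℝ)^2)),
      IsSpanner (contrG G w (ε * W / (Fintype.card V : ℝ)^2))
          (cW G w (ε * W / (Fintype.card V : ℝ)^2) ((Fintype.card V : ℝ)^2 / (W * ε)))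
          K (1 + 2 * ε) →
        wGraph H' (cW G w (ε * W / (Fintype.card V : ℝ)^2) ((Fintype.card V : ℝ)^2 / (W * ε)))
            (cW_symm G w _ _)
          ≤ C₀ * wGraph K
              (cW G w (ε * W / (Fintype.card V : ℝ)^2) ((Fintype.card V : ℝ)^2 / (W * ε)))
              (cW_symm G w _ _)) :
    ∀ K : SimpleGraph V, IsSpanner G w K (1 + ε) →
      wGraph H w hw ≤ (4 * C₀ + 4) * wGraph K w hw := by
  classical
  intro K hK
  have hpos : ∀ u v, G.Adj u v → 0 ≤ w u v := by
    intro u v h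
    obtain ⟨m, -, -, h3⟩ := hint u v h
    rw [h3]; positivity
  have hWR : (0 : ℝ) < W := by exact_mod_cast hWpos
  have hnR : (2 : ℝ) ≤ (Fintype.card V : ℝ) := by exact_mod_cast hn
  have hE1 : (G.edgeFinset.card : ℝ) ≤ 3 * (Fintype.card V : ℝ) := by
    have h : G.edgeFinset.card ≤ 3 * Fintype.card V := by
      rw [← SimpleGraph.coe_edgeFinset, Set.ncard_coe_finset] at hE3n
      exact hE3n.le
    exact_mod_cast h
  have hE2 : (G.edgeFinset.card : ℝ) * 2 ≤ (Fintype.card V : ℝ) ^ 2 := by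
    have h : (G.edgeFinset.card : ℝ) ≤ ((Fintype.card V).choose 2 : ℕ) := by
      exact_mod_cast G.card_edgeFinset_le_card_choose_two
    rw [Nat.cast_choose_two] at h
    nlinarith
  have hn0 : 0 < (Fintype.card V : ℝ) := by linarith
  have hc : 0 < ε * W / (Fintype.card V : ℝ) ^ 2 := by positivity
  have hfac : (Fintype.card V : ℝ) ^ 2 / (W * ε) * (ε * W / (Fintype.card V : ℝ) ^ 2) = 1 := by field_simp
  have hcM : ε * W / (Fintype.card V : ℝ) ^ 2 ≤ W / (Fintype.card V : ℝ) := by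
    rw [div_le_div_iff₀ (by positivity) hn0]
    have : ε * (Fintype.card V : ℝ) ≤ (Fintype.card V : ℝ) ^ 2 := by nlinarith
    nlinarith [mul_pos hWR hn0]
  have hKW : (W : ℝ) ≤ wGraph K w hw := by
    obtain ⟨u, v, h1, h2⟩ := hmaxattained
    rw [← h2]
    exact le_wGraph_of_spanner G w hw hpos K _ hK u v (hmetric u v h1)
  have a1 := H_weight hw hc hfac hcM H' hH'.1 F hFadj hFmin H hHdef
  have a2 := hH'opt _ (contrK_spanner hw hpos hc hfac hε0 hK hmetric)
  have a3 := contrK_weight (τ := ε * W / (Fintype.card V : ℝ) ^ 2 * (1 + 1 / ε)) hw hpos hc hfac hK.1 (by positivity)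
  have a4 : (G.edgeFinset.card : ℝ) * (ε * W / (Fintype.card V : ℝ) ^ 2 * (1 + 1 / ε)) ≤ W := by
    have e1 : ε * W / (Fintype.card V : ℝ) ^ 2 * (1 + 1 / ε) = W * (1 + ε) / (Fintype.card V : ℝ) ^ 2 := by field_simp; ring
    rw [e1, mul_div_assoc', div_le_iff₀ (by positivity)]
    have : (G.edgeFinset.card : ℝ) * (1 + ε) ≤ (Fintype.card V : ℝ) ^ 2 := by
      have : (0 : ℝ) ≤ G.edgeFinset.card := by positivity
      nlinarith
    nlinarith
  have a5 : (G.edgeFinset.card : ℝ) * (W / (Fintype.card V : ℝ)) ≤ 3 * W := by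
    rw [mul_div_assoc', div_le_iff₀ hn0]
    nlinarith
  have a6 := mul_le_mul_of_nonneg_left a2 hc.le
  have a7 := mul_le_mul_of_nonneg_left (a3.trans (add_le_add_right a4 _)) 
    (by linarith : (0 : ℝ) ≤ C₀)
  have a8 : C₀ * (wGraph K w hw + W) ≤ C₀ * (2 * wGraph K w hw) := by
    apply mul_le_mul_of_nonneg_left _ (by linarith)
    linarith
  rw [mul_left_comm] at a6
  have a9 := a6.trans (a7.trans a8)
  linarith

end Paper
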